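/- arXiv:2409.05471 — 8 statements merged into one kernel-verified Lean document; each statement's English description precedes it below -/
import Mathlib

section
/- Let P be an n×n real matrix and π ∈ ℝⁿ a column vector such that P·𝟙 = 𝟙, πᵀP = πᵀ, and πᵀ𝟙 = 1. If the spectral radius of P − 𝟙πᵀ (regarded as a complex matrix) is strictly less than 1, then the matrix I − P + 𝟙πᵀ is invertible, the series ∑_{k=0}^∞ (Pᵏ − 𝟙πᵀ) converges, and the fundamental matrix F := (I − P + 𝟙πᵀ)⁻¹ − 𝟙πᵀ satisfies F = ∑_{k=0}^∞ (Pᵏ − 𝟙πᵀ). -/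
open Matrix BigOperators

section helpers
open Filter Topology
open scoped Matrix.Norms.Operator

lemma summable_pow_of_spec {n : ℕ} [NeZero n] (A : Matrix (Fin n) (Fin n) ℂ)
    (h : ∀ z ∈ A.charpoly.roots, ‖z‖ < 1) : Summable (fun k : ℕ => A ^ k) := by
  have hs : spectralRadius ℂ A < ((1 : NNReal) : ENNReal) := by
    apply spectrum.spectralRadius_lt_of_forall_lt
    intro z hz
    have h1 : z ∈ A.charpoly.roots := by
      rw [Polynomial.mem_roots A.charpoly_monic.ne_zero]
      exact Matrix.mem_spectrum_iff_isRoot_charpoly.1 hz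
    exact_mod_cast h z h1
  obtain ⟨r, hr1, hr2⟩ := ENNReal.lt_iff_exists_nnreal_btwn.1 hs
  have hr2' : r < 1 := by exact_mod_cast hr2
  have ht := (spectrum.pow_nnnorm_pow_one_div_tendsto_nhds_spectralRadius A).eventually_lt_const hr1
  have hg : Summable (fun k : ℕ => (r : ℝ) ^ k) :=
    summable_geometric_of_lt_one r.2 (by exact_mod_cast hr2')
  refine Summable.of_norm_bounded_eventually_nat hg ?_
  filter_upwards [ht, eventually_gt_atTop 0] with k hk hk0
  have hk0' : (k : ℝ) ≠ 0 := by positivity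
  have h3 : (‖A ^ k‖₊ : ENNReal) ≤ (r : ENNReal) ^ k := by
    have := ENNReal.rpow_le_rpow hk.le (z := (k : ℝ)) (by positivity)
    rwa [← ENNReal.rpow_mul, one_div, inv_mul_cancel₀ hk0', ENNReal.rpow_one,
      ENNReal.rpow_natCast] at this
  have h4 : ‖A ^ k‖₊ ≤ r ^ k := by exact_mod_cast h3
  exact_mod_cast h4

end helpers

/-- If `P·𝟙 = 𝟙`, `πᵀP = πᵀ`, `πᵀ𝟙 = 1`, and the spectral radius of
`P − 𝟙πᵀ` (as a complex matrix) is `< 1`, then `I − P + 𝟙πᵀ` is invertible, the series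
`∑ (Pᵏ − 𝟙πᵀ)` converges, and the fundamental matrix `F = (I − P + 𝟙πᵀ)⁻¹ − 𝟙πᵀ`
equals this sum. -/
theorem fundamentalMatrix_eq_tsum {n : ℕ} (P : Matrix (Fin n) (Fin n) ℝ) (π : Fin n → ℝ)
    (hP1 : P.mulVec (fun _ => 1) = fun _ => 1)
    (hπP : Matrix.vecMul π P = π)
    (hπ1 : ∑ i, π i = 1)
    (hspec : ∀ z ∈ (((P - Matrix.vecMulVec (fun _ => 1) π).map
        (Complex.ofReal ·)).charpoly).roots, ‖z‖ < 1) :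
    IsUnit (1 - P + Matrix.vecMulVec (fun _ => 1) π) ∧
    Summable (fun k : ℕ => P ^ k - Matrix.vecMulVec (fun _ => 1) π) ∧
    (1 - P + Matrix.vecMulVec (fun _ => 1) π)⁻¹ - Matrix.vecMulVec (fun _ => 1) π
      = ∑' k : ℕ, (P ^ k - Matrix.vecMulVec (fun _ => 1) π) := by
  have hn : NeZero n := ⟨by rintro rfl; simp at hπ1⟩
  have hPE : P * vecMulVec (fun _ => 1) π = vecMulVec (fun _ => 1) π := by
    rw [Matrix.mul_vecMulVec, hP1]
  have hEP : vecMulVec (fun _ : Fin n => (1 : ℝ)) π * P = vecMulVec (fun _ => 1) π := by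
    rw [Matrix.vecMulVec_mul, hπP]
  have hEE : vecMulVec (fun _ : Fin n => (1 : ℝ)) π * vecMulVec (fun _ => 1) π
      = vecMulVec (fun _ : Fin n => (1 : ℝ)) π := by
    ext i j
    simp [Matrix.mul_apply, Matrix.vecMulVec_apply, ← Finset.sum_mul, hπ1]
  generalize vecMulVec (fun _ : Fin n => (1 : ℝ)) π = E at *
  have hsum : Summable (fun k : ℕ => (P - E) ^ k) := by
    have h := summable_pow_of_spec _ hspec
    refine Pi.summable.2 fun i => Pi.summable.2 fun j => ?_
    have h2 := Pi.summable.1 (Pi.summable.1 h i) j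
    rw [← Complex.summable_ofReal]
    refine h2.congr fun k => ?_
    have := congrFun (congrFun (map_pow (Complex.ofRealHom.mapMatrix) (P - E) k) i) j
    exact this.symm
  have hpow : ∀ k : ℕ, (P - E) ^ (k + 1) = P ^ (k + 1) - E := by
    intro k
    induction k with
    | zero => simp
    | succ k ih =>
      have hPkE : P ^ (k + 1) * E = E := by
        clear ih
        induction k with
        | zero => simpa using hPE
        | succ k ih => rw [pow_succ, mul_assoc, hPE, ih]
      rw [pow_succ, ih, sub_mul, mul_sub, mul_sub, hPkE, hEP, hEE, ← pow_succ]
      abel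
  obtain ⟨S, hS⟩ := hsum
  have hS1 : HasSum (fun k : ℕ => (P - E) ^ (k + 1)) (S - 1) := by
    have := (hasSum_nat_add_iff' 1).2 hS
    simpa using this
  have hS2 : HasSum (fun k : ℕ => (P - E) ^ (k + 1)) (S * (P - E)) := by
    simpa only [pow_succ] using hS.mul_right (P - E)
  have heq : S * (1 - P + E) = 1 := by
    have := hS1.unique hS2
    have h2 : S * (1 - P + E) = S - S * (P - E) := by noncomm_ring
    rw [h2, ← this]; abel
  have hF : HasSum (fun k : ℕ => P ^ k - E) (S - E) := by
    rw [← hasSum_nat_add_iff' 1]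
    simp only [hpow] at hS1
    simpa using hS1
  refine ⟨IsUnit.of_mul_eq_one_right _ heq, hF.summable, ?_⟩
  rw [hF.tsum_eq, Matrix.inv_eq_left_inv heq]
end

section
/- Let P be an n×n real matrix and π ∈ ℝⁿ a column vector such that P·𝟙 = 𝟙, πᵀP = πᵀ, and πᵀ𝟙 = 1. Then the characteristic polynomials satisfy the polynomial identity charpoly(P − 𝟙πᵀ) · (X − 1) = charpoly(P) · X. Consequently, if the complex characteristic polynomial of P has 1 as a simple root and all its other roots have modulus strictly less than 1, then every eigenvalue of P − 𝟙πᵀ has modulus strictly less than 1. -/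
open Matrix BigOperators Polynomial

theorem charpoly_aux {n : ℕ} (P : Matrix (Fin n) (Fin n) ℝ) (π : Fin n → ℝ)
    (hP1 : P.mulVec (fun _ => 1) = fun _ => 1)
    (hπ1 : ∑ i, π i = 1) :
    (P - Matrix.vecMulVec (fun _ => 1) π).charpoly * (Polynomial.X - 1)
      = P.charpoly * Polynomial.X := by
  apply Polynomial.eq_of_infinite_eval_eq
  refine Set.Infinite.mono (s := {1}ᶜ) ?_ (Set.finite_singleton (1 : ℝ)).infinite_compl
  intro x hx
  have hx1 : x - 1 ≠ 0 := sub_ne_zero.mpr hx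
  simp only [Set.mem_setOf_eq, eval_mul, eval_sub, eval_X, eval_one, Matrix.eval_charpoly]
  have key : Matrix.scalar (Fin n) x - (P - Matrix.vecMulVec (fun _ => 1) π)
      = (Matrix.scalar (Fin n) x - P) *
        (1 + Matrix.vecMulVec (fun _ => (x - 1)⁻¹) π) := by
    have hu : (Matrix.scalar (Fin n) x - P).mulVec (fun _ => (x - 1)⁻¹) = fun _ => 1 := by
      have h1 : (fun _ : Fin n => (x - 1)⁻¹) = (x - 1)⁻¹ • (fun _ : Fin n => (1 : ℝ)) := by
        ext; simp
      rw [h1, Matrix.mulVec_smul, Matrix.sub_mulVec, hP1]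
      ext i
      simp [Matrix.scalar_apply, Matrix.mulVec_diagonal, hx1]
    rw [mul_add, mul_one, Matrix.mul_vecMulVec, hu]
    abel
  rw [key, Matrix.det_mul, Matrix.vecMulVec_eq Unit,
    Matrix.det_one_add_replicateCol_mul_replicateRow]
  have : π ⬝ᵥ (fun _ => (x - 1)⁻¹) = (x - 1)⁻¹ := by
    simp [dotProduct, ← Finset.sum_mul, hπ1]
  rw [this]
  field_simp
  ring

/-- If `P·𝟙 = 𝟙`, `πᵀP = πᵀ`, `πᵀ𝟙 = 1`, then
`charpoly(P − 𝟙πᵀ)·(X − 1) = charpoly(P)·X`; consequently, if the complex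
characteristic polynomial of `P` has `1` as a simple root and all its other roots
have modulus `< 1`, then every eigenvalue of `P − 𝟙πᵀ` has modulus `< 1`. -/
theorem charpoly_sub_onePiT {n : ℕ} (P : Matrix (Fin n) (Fin n) ℝ) (π : Fin n → ℝ)
    (hP1 : P.mulVec (fun _ => 1) = fun _ => 1)
    (hπP : Matrix.vecMul π P = π)
    (hπ1 : ∑ i, π i = 1) :
    (P - Matrix.vecMulVec (fun _ => 1) π).charpoly * (Polynomial.X - 1)
      = P.charpoly * Polynomial.X ∧
    ((Polynomial.rootMultiplicity 1 ((P.map (Complex.ofReal ·)).charpoly) = 1 ∧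
        ∀ z ∈ ((P.map (Complex.ofReal ·)).charpoly).roots, z ≠ 1 → ‖z‖ < 1) →
      ∀ z ∈ (((P - Matrix.vecMulVec (fun _ => 1) π).map
          (Complex.ofReal ·)).charpoly).roots, ‖z‖ < 1) := by
  have h := charpoly_aux P π hP1 hπ1
  refine ⟨h, ?_⟩
  rintro ⟨hm, hr⟩ z hz
  have hmap : ∀ A : Matrix (Fin n) (Fin n) ℝ,
      (A.map (Complex.ofReal ·)).charpoly = A.charpoly.map Complex.ofRealHom :=
    fun A => Matrix.charpoly_map A Complex.ofRealHom
  have hC := congrArg (Polynomial.map Complex.ofRealHom) h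
  simp only [Polynomial.map_mul, Polynomial.map_sub, Polynomial.map_X, Polynomial.map_one,
    ← hmap] at hC
  have hQ0 := (Matrix.charpoly_monic
    ((P - Matrix.vecMulVec (fun _ => 1) π).map (Complex.ofReal ·))).ne_zero
  have hP0 := (Matrix.charpoly_monic (P.map (Complex.ofReal ·))).ne_zero
  have hX1 : (X - 1 : ℂ[X]) ≠ 0 := by simpa using Polynomial.X_sub_C_ne_zero (1 : ℂ)
  have hzr := (Polynomial.mem_roots hQ0).mp hz
  by_cases hz0 : z = 0
  · simp [hz0]
  by_cases hz1 : z = 1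
  · exfalso
    subst hz1
    have h1 := congrArg (Polynomial.rootMultiplicity (1 : ℂ)) hC
    rw [Polynomial.rootMultiplicity_mul (mul_ne_zero hQ0 hX1),
      Polynomial.rootMultiplicity_mul (mul_ne_zero hP0 Polynomial.X_ne_zero), hm] at h1
    have h2 : Polynomial.rootMultiplicity (1 : ℂ) (X - 1) = 1 := by
      simpa using Polynomial.rootMultiplicity_X_sub_C_self (x := (1 : ℂ))
    have h3 : Polynomial.rootMultiplicity (1 : ℂ) X = 0 :=
      Polynomial.rootMultiplicity_eq_zero (by simp)
    have h4 := (Polynomial.rootMultiplicity_pos hQ0).mpr hzr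
    omega
  · refine hr z ((Polynomial.mem_roots hP0).mpr ?_) hz1
    have h1 := congrArg (Polynomial.eval z) hC
    rw [Polynomial.eval_mul, Polynomial.eval_mul, hzr.eq_zero, zero_mul, eval_X] at h1
    exact (mul_eq_zero.mp h1.symm).resolve_right hz0
end

section
/- Let P be an n×n real matrix and π ∈ ℝⁿ a column vector such that P·𝟙 = 𝟙, πᵀP = πᵀ, and πᵀ𝟙 = 1, and suppose I − P + 𝟙πᵀ is invertible. Then the fundamental matrix F := (I − P + 𝟙πᵀ)⁻¹ − 𝟙πᵀ is the group inverse of I − P: it satisfies (I − P)·F·(I − P) = I − P, F·(I − P)·F = F, and F·(I − P) = (I − P)·F. -/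
open Matrix BigOperators

/-- If `P·𝟙 = 𝟙`, `πᵀP = πᵀ`, `πᵀ𝟙 = 1` and `I − P + 𝟙πᵀ` is
invertible, then the fundamental matrix `F = (I − P + 𝟙πᵀ)⁻¹ − 𝟙πᵀ` is the group
inverse of `I − P`:
`(I − P)·F·(I − P) = I − P`, `F·(I − P)·F = F`, and `F·(I − P) = (I − P)·F`. -/
theorem fundamentalMatrix_groupInverse {n : ℕ} (P : Matrix (Fin n) (Fin n) ℝ)
    (π : Fin n → ℝ)
    (hP1 : P.mulVec (fun _ => 1) = fun _ => 1)
    (hπP : Matrix.vecMul π P = π)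
    (hπ1 : ∑ i, π i = 1)
    (hinv : IsUnit (1 - P + Matrix.vecMulVec (fun _ => 1) π))
    (F : Matrix (Fin n) (Fin n) ℝ)
    (hF : F = (1 - P + Matrix.vecMulVec (fun _ => 1) π)⁻¹
        - Matrix.vecMulVec (fun _ => 1) π) :
    (1 - P) * F * (1 - P) = 1 - P ∧
    F * (1 - P) * F = F ∧
    F * (1 - P) = (1 - P) * F := by
  have hPW : P * Matrix.vecMulVec (fun _ : Fin n => (1 : ℝ)) π = Matrix.vecMulVec (fun _ : Fin n => (1 : ℝ)) π := by
    rw [Matrix.mul_vecMulVec, hP1]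
  have hWP : Matrix.vecMulVec (fun _ : Fin n => (1 : ℝ)) π * P = Matrix.vecMulVec (fun _ : Fin n => (1 : ℝ)) π := by
    rw [Matrix.vecMulVec_mul, hπP]
  have hWW : Matrix.vecMulVec (fun _ : Fin n => (1 : ℝ)) π * Matrix.vecMulVec (fun _ : Fin n => (1 : ℝ)) π
      = Matrix.vecMulVec (fun _ : Fin n => (1 : ℝ)) π := by
    ext i j
    simp [Matrix.mul_apply, Matrix.vecMulVec_apply, ← Finset.sum_mul, hπ1]
  have hdet := (Matrix.isUnit_iff_isUnit_det _).mp hinv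
  have hl := Matrix.nonsing_inv_mul _ hdet
  have hr := Matrix.mul_nonsing_inv _ hdet
  generalize Matrix.vecMulVec (fun _ : Fin n => (1 : ℝ)) π = W at *
  generalize (1 - P + W)⁻¹ = Z at *
  have hZW : Z * W = W := by
    have h : (1 - P + W) * W = W := by
      rw [add_mul, sub_mul, one_mul, hPW, hWW, sub_self, zero_add]
    calc Z * W = Z * ((1 - P + W) * W) := by rw [h]
      _ = W := by rw [← mul_assoc, hl, one_mul]
  have hWZ : W * Z = W := by
    have h : W * (1 - P + W) = W := by
      rw [mul_add, mul_sub, mul_one, hWP, hWW, sub_self, zero_add]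
    calc W * Z = (W * (1 - P + W)) * Z := by rw [h]
      _ = W := by rw [mul_assoc, hr, mul_one]
  have hAW : (1 - P) * W = 0 := by rw [sub_mul, one_mul, hPW, sub_self]
  have hWA : W * (1 - P) = 0 := by rw [mul_sub, mul_one, hWP, sub_self]
  have hFA : F * (1 - P) = 1 - W := by
    rw [mul_add, hZW] at hl
    rw [hF, sub_mul, hWA, sub_zero]
    exact eq_sub_of_add_eq hl
  have hAF : (1 - P) * F = 1 - W := by
    rw [add_mul, hWZ] at hr
    rw [hF, mul_sub, hAW, sub_zero]
    exact eq_sub_of_add_eq hr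
  have hWF : W * F = 0 := by rw [hF, mul_sub, hWZ, hWW, sub_self]
  refine ⟨?_, ?_, ?_⟩
  · rw [hAF, sub_mul, one_mul, hWA, sub_zero]
  · rw [hFA, sub_mul, one_mul, hWF, sub_zero]
  · rw [hFA, hAF]
end

section
/- Let P be an n×n real row-stochastic matrix (nonnegative entries, each row summing to 1) with stationary distribution π (π has nonnegative entries summing to 1 and πᵀP = πᵀ). Suppose there exist a probability vector μ ∈ ℝⁿ (nonnegative entries summing to 1), a real δ > 0, and a positive integer t such that (Pᵗ)_{i,j} ≥ δ·μ_j for all indices i, j. Then for every index i and every integer k ≥ 0, |(Pᵏ)_{i,i} − π_i| ≤ (1 − δ)^{⌊k/t⌋}. -/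
open Matrix BigOperators

/-- (Minorization / Doeblin bound, Lemma 3 of the paper.)
For a row-stochastic matrix `P` with stationary distribution `π`, if there are a
probability vector `μ`, `δ > 0` and a positive integer `t` with `(Pᵗ)_{i,j} ≥ δ·μ_j`
for all `i, j`, then `|(Pᵏ)_{i,i} − π_i| ≤ (1 − δ)^⌊k/t⌋` for all `i` and `k ≥ 0`. -/
theorem diag_pow_sub_stationary_le {n : ℕ} (P : Matrix (Fin n) (Fin n) ℝ)
    (hPnn : ∀ i j, 0 ≤ P i j) (hProw : ∀ i, ∑ j, P i j = 1)
    (π : Fin n → ℝ) (hπnn : ∀ i, 0 ≤ π i) (hπsum : ∑ i, π i = 1)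
    (hπP : Matrix.vecMul π P = π)
    (μ : Fin n → ℝ) (hμnn : ∀ j, 0 ≤ μ j) (hμsum : ∑ j, μ j = 1)
    (δ : ℝ) (hδ : 0 < δ) (t : ℕ) (ht : 1 ≤ t)
    (hminor : ∀ i j, (P ^ t) i j ≥ δ * μ j) :
    ∀ (i : Fin n) (k : ℕ), |(P ^ k) i i - π i| ≤ (1 - δ) ^ (k / t) := by
  have hnn : ∀ k i j, 0 ≤ (P ^ k) i j := by
    intro k
    induction k with
    | zero => intro i j; rw [pow_zero, Matrix.one_apply]; split_ifs <;> norm_num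
    | succ k ih =>
      intro i j
      rw [pow_succ, Matrix.mul_apply]
      exact Finset.sum_nonneg fun l _ => mul_nonneg (ih i l) (hPnn l j)
  have hrow : ∀ k i, ∑ j, (P ^ k) i j = 1 := by
    intro k
    induction k with
    | zero => intro i; simp [Matrix.one_apply]
    | succ k ih =>
      intro i
      simp only [pow_succ, Matrix.mul_apply]
      rw [Finset.sum_comm]
      simp only [← Finset.mul_sum, hProw, mul_one, ih]
  have hstat : ∀ k, Matrix.vecMul π (P ^ k) = π := by
    intro k
    induction k with
    | zero => simp
    | succ k ih => rw [pow_succ, ← Matrix.vecMul_vecMul, ih, hπP]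
  -- oscillation of each column contracts by `1 - δ` every `t` steps
  have hosc : ∀ j r m, ∃ lo : ℝ, ∀ i, lo ≤ (P ^ (t * m + r)) i j ∧
      (P ^ (t * m + r)) i j ≤ lo + (1 - δ) ^ m := by
    intro j r m
    induction m with
    | zero =>
      refine ⟨0, fun i => ⟨hnn _ i j, ?_⟩⟩
      rw [pow_zero, zero_add, ← hrow (t * 0 + r) i]
      exact Finset.single_le_sum (f := fun j => (P ^ (t * 0 + r)) i j)
        (fun l _ => hnn _ i l) (Finset.mem_univ j)
    | succ m ih =>
      obtain ⟨lo, hlo⟩ := ih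
      set A := P ^ (t * m + r) with hA
      have hpow : P ^ (t * (m + 1) + r) = P ^ t * A := by
        rw [hA, ← pow_add]; congr 1; ring
      refine ⟨(1 - δ) * lo + δ * ∑ l, μ l * A l j, fun i => ?_⟩
      have hdec : (P ^ t * A) i j =
          ∑ l, ((P ^ t) i l - δ * μ l) * A l j + δ * ∑ l, μ l * A l j := by
        rw [Matrix.mul_apply, Finset.mul_sum, ← Finset.sum_add_distrib]
        exact Finset.sum_congr rfl fun l _ => by ring
      have hw : ∀ c : ℝ, ∑ l, ((P ^ t) i l - δ * μ l) * c = (1 - δ) * c := by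
        intro c
        rw [← Finset.sum_mul, Finset.sum_sub_distrib, hrow, ← Finset.mul_sum, hμsum, mul_one]
      have h1 : (1 - δ) * lo ≤ ∑ l, ((P ^ t) i l - δ * μ l) * A l j := by
        rw [← hw]
        exact Finset.sum_le_sum fun l _ =>
          mul_le_mul_of_nonneg_left (hlo l).1 (sub_nonneg.2 (hminor i l))
      have h2 : ∑ l, ((P ^ t) i l - δ * μ l) * A l j ≤ (1 - δ) * (lo + (1 - δ) ^ m) := by
        rw [← hw]
        exact Finset.sum_le_sum fun l _ =>
          mul_le_mul_of_nonneg_left (hlo l).2 (sub_nonneg.2 (hminor i l))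
      rw [hpow, hdec, pow_succ]
      constructor <;> linarith
  intro i k
  obtain ⟨lo, hlo⟩ := hosc i (k % t) (k / t)
  rw [Nat.div_add_mod] at hlo
  have hπi : ∑ l, π l * (P ^ k) l i = π i := congrFun (hstat k) i
  have hc : ∀ c : ℝ, ∑ l, π l * c = c := by
    intro c; rw [← Finset.sum_mul, hπsum, one_mul]
  have h1 : lo ≤ π i := by
    rw [← hπi, ← hc lo]
    exact Finset.sum_le_sum fun l _ => mul_le_mul_of_nonneg_left (hlo l).1 (hπnn l)
  have h2 : π i ≤ lo + (1 - δ) ^ (k / t) := by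
    rw [← hπi, ← hc (lo + _)]
    exact Finset.sum_le_sum fun l _ => mul_le_mul_of_nonneg_left (hlo l).2 (hπnn l)
  rw [abs_le]
  constructor <;> linarith [(hlo i).1, (hlo i).2]
end

section
/- Let P be an n×n real row-stochastic matrix with stationary distribution π. Let τ ≥ 1 be an integer and d > 1 a real number such that (P^τ)_{i,j} ≥ d^{−τ} for all indices i, j, and set δ := n·d^{−τ}, assuming 0 < δ < 1. Then for every ε > 0 and every natural number l with l ≥ τ·log(n·ε·τ^{−1}·d^{−τ}) / log(1 − n·d^{−τ}) + τ − 1, and for every index i, the tail sum satisfies ∑_{k=l+1}^∞ |(Pᵏ)_{i,i} − π_i| ≤ τ·(1−δ)^{⌊(l+1)/τ⌋} / δ ≤ ε. -/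
open Matrix BigOperators

theorem aux_row {n : ℕ} (P : Matrix (Fin n) (Fin n) ℝ)
    (hPnn : ∀ i j, 0 ≤ P i j) (hProw : ∀ i, ∑ j, P i j = 1) (k : ℕ) :
    (∀ i j, 0 ≤ (P ^ k) i j) ∧ (∀ i, ∑ j, (P ^ k) i j = 1) := by
  induction k with
  | zero =>
    constructor
    · intro i j
      rw [pow_zero, Matrix.one_apply]
      split_ifs <;> norm_num
    · intro i
      simp [Matrix.one_apply]
  | succ k ih =>
    constructor
    · intro i j
      rw [pow_succ, Matrix.mul_apply]
      exact Finset.sum_nonneg fun a _ => mul_nonneg (ih.1 i a) (hPnn a j)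
    · intro i
      simp_rw [pow_succ, Matrix.mul_apply]
      rw [Finset.sum_comm]
      simp_rw [← Finset.mul_sum, hProw, mul_one]
      exact ih.2 i

theorem aux_contract {n : ℕ} (Q : Matrix (Fin n) (Fin n) ℝ) (c δ M : ℝ)
    (hc : ∀ i j, c ≤ Q i j) (hrow : ∀ i, ∑ j, Q i j = 1)
    (hδ : δ = n * c) (hδ1 : δ < 1) (g : Fin n → ℝ) (hg : ∀ a b, g a - g b ≤ M)
    (i i' : Fin n) : ∑ a, Q i a * g a - ∑ a, Q i' a * g a ≤ (1 - δ) * M := by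
  have hr : ∀ i, ∑ a, (Q i a - c) = 1 - δ := by
    intro i
    rw [Finset.sum_sub_distrib, hrow, hδ]
    simp
  have h1 : ∀ b, ∑ a, (Q i a - c) * g a ≤ (1 - δ) * (g b + M) := by
    intro b
    rw [← hr i, Finset.sum_mul]
    apply Finset.sum_le_sum
    intro a _
    apply mul_le_mul_of_nonneg_left _ (by linarith [hc i a])
    linarith [hg a b]
  have h2 : (1 - δ) * ∑ a, (Q i a - c) * g a
      ≤ (1 - δ) * (∑ b, (Q i' b - c) * g b + (1 - δ) * M) := by
    calc (1 - δ) * ∑ a, (Q i a - c) * g a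
        = ∑ b, (Q i' b - c) * (∑ a, (Q i a - c) * g a) := by
          rw [← Finset.sum_mul, hr]
      _ ≤ ∑ b, (Q i' b - c) * ((1 - δ) * (g b + M)) :=
          Finset.sum_le_sum fun b _ =>
            mul_le_mul_of_nonneg_left (h1 b) (by linarith [hc i' b])
      _ = (1 - δ) * (∑ b, (Q i' b - c) * g b + (∑ b, (Q i' b - c)) * M) := by
          rw [Finset.sum_mul, ← Finset.sum_add_distrib, Finset.mul_sum]
          exact Finset.sum_congr rfl fun b _ => by ring
      _ = _ := by rw [hr]
  have h3 := le_of_mul_le_mul_left h2 (by linarith)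
  simp_rw [sub_mul, Finset.sum_sub_distrib] at h3
  linarith

theorem aux_hasSum (τ : ℕ) (hτ : 1 ≤ τ) (r : ℝ) (h0 : 0 ≤ r) (h1 : r < 1) :
    HasSum (fun m : ℕ => r ^ (m / τ)) (τ * (1 - r)⁻¹) := by
  have : NeZero τ := ⟨by omega⟩
  have hA := hasSum_geometric_of_lt_one h0 h1
  have hB : HasSum (fun _ : Fin τ => (1 : ℝ)) τ := by
    simpa using hasSum_fintype (fun _ : Fin τ => (1 : ℝ))
  have hS : Summable (fun x : ℕ × Fin τ => r ^ x.1 * (1 : ℝ)) :=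
    hA.summable.mul_of_nonneg hB.summable (fun _ => pow_nonneg h0 _) (fun _ => zero_le_one)
  have h := hA.mul hB hS
  have h' := (Nat.divModEquiv τ).hasSum_iff.mpr h
  rw [mul_comm]
  have e : (fun m : ℕ => r ^ (m / τ))
      = (fun x : ℕ × Fin τ => r ^ x.1 * (1 : ℝ)) ∘ (Nat.divModEquiv τ) := by
    funext m
    simp [Nat.divModEquiv]
  rw [e]
  exact h'

/-- (Lemma 4 of the paper.) For a row-stochastic matrix `P` with
stationary distribution `π`, if `(P^τ)_{i,j} ≥ d^{−τ}` for all `i,j`, and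
`δ := n·d^{−τ}` satisfies `0 < δ < 1`, then for every `ε > 0` and every `l` with
`l ≥ τ·log(n·ε·τ⁻¹·d^{−τ})/log(1 − n·d^{−τ}) + τ − 1`, and every index `i`, the tail
sum `∑_{k=l+1}^∞ |(Pᵏ)_{i,i} − π_i|` is at most `τ·(1−δ)^⌊(l+1)/τ⌋/δ ≤ ε`. -/
theorem diag_truncation_error {n : ℕ} (P : Matrix (Fin n) (Fin n) ℝ)
    (hPnn : ∀ i j, 0 ≤ P i j) (hProw : ∀ i, ∑ j, P i j = 1)
    (π : Fin n → ℝ) (hπnn : ∀ i, 0 ≤ π i) (hπsum : ∑ i, π i = 1)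
    (hπP : Matrix.vecMul π P = π)
    (τ : ℕ) (hτ : 1 ≤ τ) (d : ℝ) (hd : 1 < d)
    (hminor : ∀ i j, (P ^ τ) i j ≥ d ^ (-(τ : ℤ)))
    (δ : ℝ) (hδdef : δ = n * d ^ (-(τ : ℤ)))
    (hδ0 : 0 < δ) (hδ1 : δ < 1)
    (ε : ℝ) (hε : 0 < ε) (l : ℕ)
    (hl : (l : ℝ) ≥ τ * Real.log (n * ε * (τ : ℝ)⁻¹ * d ^ (-(τ : ℤ)))
        / Real.log (1 - n * d ^ (-(τ : ℤ))) + τ - 1) :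
    ∀ i : Fin n,
      Summable (fun k : ℕ => |(P ^ (k + l + 1)) i i - π i|) ∧
      (∑' k : ℕ, |(P ^ (k + l + 1)) i i - π i|) ≤ τ * (1 - δ) ^ ((l + 1) / τ) / δ ∧
      τ * (1 - δ) ^ ((l + 1) / τ) / δ ≤ ε := by
  have hst := aux_row P hPnn hProw
  have hosc : ∀ (q r : ℕ) (j a b : Fin n),
      (P ^ (τ * q + r)) a j - (P ^ (τ * q + r)) b j ≤ (1 - δ) ^ q := by
    intro q
    induction q with
    | zero =>
      intro r j a b
      have h1 := (hst (τ * 0 + r)).1 b j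
      have h2 : (P ^ (τ * 0 + r)) a j ≤ 1 := by
        rw [← (hst (τ * 0 + r)).2 a]
        exact Finset.single_le_sum (f := fun j => (P ^ (τ * 0 + r)) a j)
          (fun x _ => (hst (τ * 0 + r)).1 a x) (Finset.mem_univ j)
      rw [pow_zero]
      linarith
    | succ q ih =>
      intro r j a b
      have e : τ * (q + 1) + r = τ + (τ * q + r) := by ring
      rw [e, pow_add P, Matrix.mul_apply, Matrix.mul_apply, pow_succ' (1 - δ)]
      exact aux_contract (P ^ τ) (d ^ (-(τ : ℤ))) δ _ hminor (hst τ).2 hδdef hδ1 _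
        (fun x y => ih r j x y) a b
  have hosc' : ∀ (k : ℕ) (j a b : Fin n),
      (P ^ k) a j - (P ^ k) b j ≤ (1 - δ) ^ (k / τ) := by
    intro k j a b
    have := hosc (k / τ) (k % τ) j a b
    rwa [Nat.div_add_mod] at this
  have hπk : ∀ k : ℕ, Matrix.vecMul π (P ^ k) = π := by
    intro k
    induction k with
    | zero => simp
    | succ k ih => rw [pow_succ, ← Matrix.vecMul_vecMul, ih, hπP]
  have hpt : ∀ (k : ℕ) (i : Fin n), |(P ^ k) i i - π i| ≤ (1 - δ) ^ (k / τ) := by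
    intro k i
    have e : (P ^ k) i i - π i = ∑ a, π a * ((P ^ k) i i - (P ^ k) a i) := by
      simp_rw [mul_sub, Finset.sum_sub_distrib, ← Finset.sum_mul, hπsum, one_mul]
      congr 1
      exact (congrFun (hπk k) i).symm
    rw [e]
    calc _ ≤ ∑ a, |π a * ((P ^ k) i i - (P ^ k) a i)| := Finset.abs_sum_le_sum_abs _ _
      _ ≤ ∑ a, π a * (1 - δ) ^ (k / τ) := by
        apply Finset.sum_le_sum
        intro a _
        rw [abs_mul, abs_of_nonneg (hπnn a)]
        apply mul_le_mul_of_nonneg_left _ (hπnn a)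
        rw [abs_le]
        constructor <;> linarith [hosc' k i i a, hosc' k i a i]
      _ = _ := by rw [← Finset.sum_mul, hπsum, one_mul]
  intro i
  have hs := (aux_hasSum τ hτ (1 - δ) (by linarith) (by linarith)).mul_left
    ((1 - δ) ^ ((l + 1) / τ))
  have hle : ∀ k : ℕ, |(P ^ (k + l + 1)) i i - π i|
      ≤ (1 - δ) ^ ((l + 1) / τ) * (1 - δ) ^ (k / τ) := by
    intro k
    refine (hpt _ i).trans ?_
    rw [← pow_add]
    apply pow_le_pow_of_le_one (by linarith) (by linarith)
    rw [Nat.le_div_iff_mul_le (by omega), add_mul]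
    have h1 := Nat.div_mul_le_self (l + 1) τ
    have h2 := Nat.div_mul_le_self k τ
    omega
  have hsum : Summable (fun k : ℕ => |(P ^ (k + l + 1)) i i - π i|) :=
    Summable.of_nonneg_of_le (fun _ => abs_nonneg _) hle hs.summable
  refine ⟨hsum, ?_, ?_⟩
  · refine (hsum.tsum_le_tsum hle hs.summable).trans ?_
    rw [hs.tsum_eq, sub_sub_cancel, div_eq_mul_inv]
    apply le_of_eq
    ring
  · have hτ0 : (0 : ℝ) < τ := by exact_mod_cast hτ
    have hx : (n : ℝ) * ε * (τ : ℝ)⁻¹ * d ^ (-(τ : ℤ)) = ε * δ / τ := by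
      rw [hδdef, div_eq_mul_inv]
      ring
    rw [hx, ← hδdef] at hl
    have hlog : Real.log (1 - δ) < 0 := Real.log_neg (by linarith) (by linarith)
    have hfl : ((l : ℝ) + 1) < τ * (((l + 1) / τ : ℕ) + 1) := by
      exact_mod_cast Nat.lt_mul_div_succ (l + 1) (by omega : 0 < τ)
    set q := (l + 1) / τ
    have hq : Real.log (ε * δ / τ) / Real.log (1 - δ) < q := by
      rw [mul_div_assoc] at hl
      have : τ * (Real.log (ε * δ / τ) / Real.log (1 - δ)) < τ * q := by linarith
      exact lt_of_mul_lt_mul_left this hτ0.le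
    rw [div_lt_iff_of_neg hlog] at hq
    have hpow : (1 - δ) ^ q ≤ ε * δ / τ := by
      rw [← Real.log_le_log_iff (pow_pos (by linarith) _) (by positivity), Real.log_pow]
      exact hq.le
    rw [div_le_iff₀ hδ0]
    rw [le_div_iff₀ hτ0] at hpow
    linarith
end

section
/- Let P be an n×n real matrix and π ∈ ℝⁿ a column vector with strictly positive entries such that P·𝟙 = 𝟙, πᵀP = πᵀ, and πᵀ𝟙 = 1. Suppose I − P + 𝟙πᵀ is invertible, let F := (I − P + 𝟙πᵀ)⁻¹ − 𝟙πᵀ be the fundamental matrix, and fix an index s such that the (n−1)×(n−1) submatrix (I − P)_{−s} (obtained from I − P by deleting row s and column s) is invertible. Then trace( ((I − P)_{−s})⁻¹ ) = trace(F) + F_{s,s}/π_s. Equivalently, Kemeny's constant K = trace(F) satisfies K = trace( ((I − P)_{−s})⁻¹ ) − F_{s,s}/π_s. -/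
open Matrix BigOperators

/-- (Theorem 1 of the paper.) For a chain with transition matrix `P`,
positive stationary vector `π` and fundamental matrix `F = (I − P + 𝟙πᵀ)⁻¹ − 𝟙πᵀ`, if
the submatrix `(I − P)_{−s}` (delete row and column `s`) is invertible, then
`trace(((I − P)_{−s})⁻¹) = trace(F) + F_{s,s}/π_s`; equivalently, Kemeny's constant
`K = trace(F)` satisfies `K = trace(((I − P)_{−s})⁻¹) − F_{s,s}/π_s`. -/
theorem kemeny_eq_trace_submatrix_inv {n : ℕ}
    (P : Matrix (Fin (n + 1)) (Fin (n + 1)) ℝ) (π : Fin (n + 1) → ℝ)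
    (hπpos : ∀ i, 0 < π i)
    (hP1 : P.mulVec (fun _ => 1) = fun _ => 1)
    (hπP : Matrix.vecMul π P = π)
    (hπ1 : ∑ i, π i = 1)
    (hinv : IsUnit (1 - P + Matrix.vecMulVec (fun _ => 1) π))
    (F : Matrix (Fin (n + 1)) (Fin (n + 1)) ℝ)
    (hF : F = (1 - P + Matrix.vecMulVec (fun _ => 1) π)⁻¹
        - Matrix.vecMulVec (fun _ => 1) π)
    (s : Fin (n + 1))
    (hsub : IsUnit ((1 - P).submatrix s.succAbove s.succAbove)) :
    (((1 - P).submatrix s.succAbove s.succAbove)⁻¹).trace = F.trace + F s s / π s ∧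
    F.trace = (((1 - P).submatrix s.succAbove s.succAbove)⁻¹).trace - F s s / π s := by
  have key : (((1 - P).submatrix s.succAbove s.succAbove)⁻¹).trace = F.trace + F s s / π s := by
    set J : Matrix (Fin (n + 1)) (Fin (n + 1)) ℝ := Matrix.vecMulVec (fun _ => 1) π with hJ
    set B := 1 - P + J with hB
    have hPJ : P * J = J := by rw [hJ, Matrix.mul_vecMulVec, hP1]
    have hJP : J * P = J := by rw [hJ, Matrix.vecMulVec_mul, hπP]
    have hJJ : J * J = J := by
      ext i j
      simp [hJ, Matrix.mul_apply, Matrix.vecMulVec_apply, ← Finset.sum_mul, hπ1]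
    have hdet : IsUnit B.det := (Matrix.isUnit_iff_isUnit_det B).1 hinv
    have hBB : B * B⁻¹ = 1 := Matrix.mul_nonsing_inv B hdet
    have hBB2 : B⁻¹ * B = 1 := Matrix.nonsing_inv_mul B hdet
    have hBJ : B * J = J := by
      rw [hB, add_mul, sub_mul, one_mul, hPJ, hJJ]; simp
    have hJB : J * B = J := by
      rw [hB, mul_add, mul_sub, mul_one, hJP, hJJ]; simp
    have hBiJ : B⁻¹ * J = J := by
      calc B⁻¹ * J = B⁻¹ * (B * J) := by rw [hBJ]
        _ = J := by rw [← mul_assoc, hBB2, one_mul]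
    have hJBi : J * B⁻¹ = J := by
      calc J * B⁻¹ = (J * B) * B⁻¹ := by rw [hJB]
        _ = J := by rw [mul_assoc, hBB, mul_one]
    have hFJ : F * J = 0 := by rw [hF, sub_mul, hBiJ, hJJ, sub_self]
    have hJF : J * F = 0 := by rw [hF, mul_sub, hJBi, hJJ, sub_self]
    have hAF : (1 - P) * F = 1 - J := by
      have h : (1 - P) = B - J := by rw [hB]; abel
      rw [h, sub_mul, hJF, sub_zero, hF, mul_sub, hBB, hBJ]
    have hs : π s ≠ 0 := (hπpos s).ne'
    have hF1 : ∀ i, ∑ k, F i k = 0 := by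
      intro i
      have h := congrFun (congrFun hFJ i) s
      simp only [hJ, Matrix.mul_apply, Matrix.vecMulVec_apply, one_mul, Matrix.zero_apply,
        ← Finset.sum_mul] at h
      exact (mul_eq_zero.1 h).resolve_right hs
    have hπF : ∀ j, ∑ k, π k * F k j = 0 := by
      intro j
      have h := congrFun (congrFun hJF s) j
      simpa only [hJ, Matrix.mul_apply, Matrix.vecMulVec_apply, one_mul, Matrix.zero_apply] using h
    have hA1 : ∀ i, ∑ k, (1 - P) i k = 0 := by
      intro i
      have h := congrFun hP1 i
      simp only [Matrix.mulVec, dotProduct, mul_one] at h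
      simp [Matrix.sub_apply, Finset.sum_sub_distrib, h, Matrix.one_apply]
    have hAFe : ∀ i j, ∑ k, (1 - P) i k * F k j = (1 : Matrix _ _ ℝ) i j - π j := by
      intro i j
      have h := congrFun (congrFun hAF i) j
      simpa only [hJ, Matrix.mul_apply, Matrix.vecMulVec_apply, one_mul, Matrix.sub_apply] using h
    generalize hA : (1 - P) = A at hA1 hAFe ⊢
    let G : Matrix (Fin (n + 1)) (Fin (n + 1)) ℝ :=
      fun i j => F i j - F s j - π j / π s * (F i s - F s s)
    have hGs : ∀ j, G s j = 0 := by intro j; simp [G]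
    have hAG : ∀ i j, i ≠ s → ∑ k, A i k * G k j = (1 : Matrix _ _ ℝ) i j := by
      intro i j hi
      have e : ∑ k, A i k * G k j = ∑ k, A i k * F k j - (∑ k, A i k) * F s j
          - π j / π s * (∑ k, A i k * F k s - (∑ k, A i k) * F s s) := by
        simp only [Finset.sum_mul, Finset.mul_sum, ← Finset.sum_sub_distrib]
        refine Finset.sum_congr rfl fun k _ => ?_
        simp only [G]; ring
      rw [e, hA1, hAFe, hAFe, Matrix.one_apply_ne hi]
      field_simp
      ring
    have hinvG : (A.submatrix s.succAbove s.succAbove)⁻¹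
        = G.submatrix s.succAbove s.succAbove := by
      apply Matrix.inv_eq_right_inv
      ext i j
      have h := hAG (s.succAbove i) (s.succAbove j) (Fin.succAbove_ne s i)
      rw [Fin.sum_univ_succAbove _ s, hGs, mul_zero, zero_add] at h
      simp only [Matrix.mul_apply, Matrix.submatrix_apply]
      rw [h]
      simp [Matrix.one_apply]
    have htr : ∑ j, G j j = F.trace + F s s / π s := by
      have e : ∑ j, G j j = ∑ j, F j j - ∑ j, F s j
          - (∑ j, π j * F j s - (∑ j, π j) * F s s) / π s := by
        simp only [Finset.sum_mul, Finset.sum_div, ← Finset.sum_sub_distrib]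
        refine Finset.sum_congr rfl fun k _ => ?_
        simp only [G]; ring
      rw [e, hF1, hπF, hπ1]
      simp only [Matrix.trace, Matrix.diag_apply]
      ring
    rw [hinvG, ← htr, Fin.sum_univ_succAbove _ s, hGs, zero_add]
    rfl
  exact ⟨key, by rw [key]; ring⟩
end

section
/- Let P be an n×n real matrix and π ∈ ℝⁿ a column vector with strictly positive entries such that P·𝟙 = 𝟙, πᵀP = πᵀ, and πᵀ𝟙 = 1, and suppose I − P + 𝟙πᵀ is invertible. Let F := (I − P + 𝟙πᵀ)⁻¹ − 𝟙πᵀ, let Π := diag(π₁,…,πₙ), Ñ := Π^{1/2}·F·Π^{−1/2}, and L̃ := Π^{1/2}·(I − P)·Π^{−1/2}. Fix an index s, set T := {1,…,n}∖{s}, and let π̃ ∈ ℝ^{T} be the vector with entries π̃_i = (π_i/π_s)^{1/2}. Define the (n−1)×(n−1) matrix X by X_{i,j} = Ñ_{i,j} − π̃_i·Ñ_{s,j} − Ñ_{i,s}·π̃_j + π̃_i·Ñ_{s,s}·π̃_j for i,j ∈ T. Then L̃_{−s}·X·L̃_{−s} = L̃_{−s}; in particular, if L̃_{−s} is invertible then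 X = (L̃_{−s})⁻¹. -/
open Matrix BigOperators

/-- (Key identity in the proof of Theorem 1.) With
`Ñ = Π^{1/2}·F·Π^{−1/2}`, `L̃ = Π^{1/2}·(I − P)·Π^{−1/2}`, `π̃_i = (π_i/π_s)^{1/2}`
and `X_{i,j} = Ñ_{i,j} − π̃_i·Ñ_{s,j} − Ñ_{i,s}·π̃_j + π̃_i·Ñ_{s,s}·π̃_j` on
`T = V∖{s}`, one has `L̃_{−s}·X·L̃_{−s} = L̃_{−s}`; in particular, if `L̃_{−s}` is
invertible then `X = (L̃_{−s})⁻¹`. -/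
theorem scaled_fundamental_submatrix_inv {n : ℕ}
    (P : Matrix (Fin (n + 1)) (Fin (n + 1)) ℝ) (π : Fin (n + 1) → ℝ)
    (hπpos : ∀ i, 0 < π i)
    (hP1 : P.mulVec (fun _ => 1) = fun _ => 1)
    (hπP : Matrix.vecMul π P = π)
    (hπ1 : ∑ i, π i = 1)
    (hinv : IsUnit (1 - P + Matrix.vecMulVec (fun _ => 1) π))
    (F : Matrix (Fin (n + 1)) (Fin (n + 1)) ℝ)
    (hF : F = (1 - P + Matrix.vecMulVec (fun _ => 1) π)⁻¹
        - Matrix.vecMulVec (fun _ => 1) π)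
    (N : Matrix (Fin (n + 1)) (Fin (n + 1)) ℝ)
    (hN : N = Matrix.diagonal (fun i => Real.sqrt (π i)) * F
        * Matrix.diagonal (fun i => (Real.sqrt (π i))⁻¹))
    (L : Matrix (Fin (n + 1)) (Fin (n + 1)) ℝ)
    (hL : L = Matrix.diagonal (fun i => Real.sqrt (π i)) * (1 - P)
        * Matrix.diagonal (fun i => (Real.sqrt (π i))⁻¹))
    (s : Fin (n + 1))
    (πt : Fin n → ℝ) (hπt : ∀ i, πt i = Real.sqrt (π (s.succAbove i) / π s))
    (X : Matrix (Fin n) (Fin n) ℝ)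
    (hX : ∀ i j, X i j = N (s.succAbove i) (s.succAbove j)
        - πt i * N s (s.succAbove j)
        - N (s.succAbove i) s * πt j
        + πt i * N s s * πt j) :
    L.submatrix s.succAbove s.succAbove * X * L.submatrix s.succAbove s.succAbove
      = L.submatrix s.succAbove s.succAbove ∧
    (IsUnit (L.submatrix s.succAbove s.succAbove) →
      X = (L.submatrix s.succAbove s.succAbove)⁻¹) := by
  have hq : ∀ i, Real.sqrt (π i) ≠ 0 := fun i => (Real.sqrt_pos.2 (hπpos i)).ne'
  have hqq : ∀ i, Real.sqrt (π i) * Real.sqrt (π i) = π i :=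
    fun i => Real.mul_self_sqrt (hπpos i).le
  have hDD : Matrix.diagonal (fun i => (Real.sqrt (π i))⁻¹)
      * Matrix.diagonal (fun i => Real.sqrt (π i)) = 1 := by
    rw [Matrix.diagonal_mul_diagonal, ← Matrix.diagonal_one]
    congr 1
    funext i
    exact inv_mul_cancel₀ (hq i)
  -- the unscaled identity
  have hFid : (1 - P) * F * (1 - P) = 1 - P := by
    set J := Matrix.vecMulVec (fun _ : Fin (n + 1) => (1 : ℝ)) π with hJ
    have hPJ : P * J = J := by
      rw [hJ, Matrix.mul_vecMulVec, hP1]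
    have hJP : J * P = J := by
      rw [hJ, Matrix.vecMulVec_mul, hπP]
    have hJJ : J * J = J := by
      ext i j
      simp [hJ, Matrix.mul_apply, Matrix.vecMulVec_apply, ← Finset.sum_mul, hπ1]
    set A := 1 - P + J with hA
    have hdet : IsUnit A.det := (Matrix.isUnit_iff_isUnit_det A).1 hinv
    have hAZ : A * A⁻¹ = 1 := Matrix.mul_nonsing_inv A hdet
    have hJA : J * A = J := by
      rw [hA, mul_add, mul_sub, mul_one, hJP, hJJ]; abel
    have hAJ : A * J = J := by
      rw [hA, add_mul, sub_mul, one_mul, hPJ, hJJ]; abel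
    have hJZ : J * A⁻¹ = J := by
      calc J * A⁻¹ = (J * A) * A⁻¹ := by rw [hJA]
        _ = J := by rw [mul_assoc, hAZ, mul_one]
    have h1 : 1 - P = A - J := by rw [hA]; abel
    rw [h1, hF]
    have h2 : (A - J) * (A⁻¹ - J) = 1 - J := by
      rw [sub_mul, mul_sub, mul_sub, hAZ, hAJ, hJZ, hJJ]; abel
    rw [h2, sub_mul, mul_sub J, hJA, hJJ]
    simp
  have hLNL : L * N * L = L := by
    rw [hL, hN]
    set D := Matrix.diagonal (fun i => Real.sqrt (π i))
    set D' := Matrix.diagonal (fun i => (Real.sqrt (π i))⁻¹)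
    calc D * (1 - P) * D' * (D * F * D') * (D * (1 - P) * D')
        = D * ((1 - P) * (D' * D) * F * (D' * D) * (1 - P)) * D' := by
          simp only [Matrix.mul_assoc]
      _ = D * (1 - P) * D' := by rw [hDD, mul_one, mul_one, hFid]
  have hLe : ∀ i j, L i j = Real.sqrt (π i) * (1 - P) i j * (Real.sqrt (π j))⁻¹ := by
    intro i j
    rw [hL, Matrix.mul_diagonal, Matrix.diagonal_mul]
  have hR : ∀ i, ∑ k, L i k * Real.sqrt (π k) = 0 := by
    intro i
    have h : (1 - P).mulVec (fun _ => 1) i = 0 := by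
      rw [Matrix.sub_mulVec, hP1, Matrix.one_mulVec]; simp
    have h' : ∑ k, (1 - P) i k = 0 := by
      simpa [Matrix.mulVec, dotProduct] using h
    calc ∑ k, L i k * Real.sqrt (π k) = ∑ k, Real.sqrt (π i) * (1 - P) i k :=
          Finset.sum_congr rfl fun k _ => by
            rw [hLe, inv_mul_cancel_right₀ (hq k)]
      _ = 0 := by rw [← Finset.mul_sum, h', mul_zero]
  have hC : ∀ j, ∑ k, Real.sqrt (π k) * L k j = 0 := by
    intro j
    have h : Matrix.vecMul π (1 - P) j = 0 := by
      rw [Matrix.vecMul_sub, hπP, Matrix.vecMul_one]; simp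
    have h' : ∑ k, π k * (1 - P) k j = 0 := h
    calc ∑ k, Real.sqrt (π k) * L k j
        = ∑ k, π k * (1 - P) k j * (Real.sqrt (π j))⁻¹ :=
          Finset.sum_congr rfl fun k _ => by
            rw [hLe, ← mul_assoc, ← mul_assoc, hqq]
      _ = 0 := by rw [← Finset.sum_mul, h', zero_mul]
  have hπt' : ∀ i, πt i = Real.sqrt (π (s.succAbove i)) / Real.sqrt (π s) := fun i => by
    rw [hπt, Real.sqrt_div (hπpos _).le]
  let C : Matrix (Fin n) (Fin (n + 1)) ℝ :=
    fun i j => (if j = s.succAbove i then 1 else 0) - (if j = s then πt i else 0)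
  have hCs : ∀ i, C i s = - πt i := fun i => by
    simp [C, (Fin.succAbove_ne s i).symm]
  have hCt : ∀ i k, C i (s.succAbove k) = if k = i then 1 else 0 := fun i k => by
    simp [C, Fin.succAbove_ne s k]
  have e1 : L.submatrix id s.succAbove * C = L := by
    ext i j
    rw [Matrix.mul_apply]
    refine Fin.succAboveCases s ?_ (fun k => ?_) j
    · have h := hR i
      rw [Fin.sum_univ_succAbove _ s] at h
      simp only [hCs, hπt', Matrix.submatrix_apply, id]
      have : ∑ x, L i (s.succAbove x) * -(Real.sqrt (π (s.succAbove x)) / Real.sqrt (π s))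
          = -(∑ x, L i (s.succAbove x) * Real.sqrt (π (s.succAbove x))) / Real.sqrt (π s) := by
        rw [← Finset.sum_neg_distrib, Finset.sum_div]
        exact Finset.sum_congr rfl fun x _ => by ring
      rw [this, div_eq_iff (hq s)]
      linarith
    · simp [hCt]
  have e2 : Cᵀ * L.submatrix s.succAbove id = L := by
    ext i j
    rw [Matrix.mul_apply]
    refine Fin.succAboveCases s ?_ (fun k => ?_) i
    · have h := hC j
      rw [Fin.sum_univ_succAbove _ s] at h
      simp only [Matrix.transpose_apply, hCs, hπt', Matrix.submatrix_apply, id]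
      have : ∑ x, -(Real.sqrt (π (s.succAbove x)) / Real.sqrt (π s)) * L (s.succAbove x) j
          = -(∑ x, Real.sqrt (π (s.succAbove x)) * L (s.succAbove x) j) / Real.sqrt (π s) := by
        rw [← Finset.sum_neg_distrib, Finset.sum_div]
        exact Finset.sum_congr rfl fun x _ => by ring
      rw [this, div_eq_iff (hq s)]
      linarith
    · simp [hCt]
  have e3 : X = C * N * Cᵀ := by
    ext i j
    rw [hX]
    simp only [Matrix.mul_apply, Matrix.transpose_apply]
    simp only [Fin.sum_univ_succAbove _ s, hCs, hCt]
    simp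
    ring
  have e1' : L.submatrix s.succAbove s.succAbove * C = L.submatrix s.succAbove id := by
    have := congrArg (fun M => M.submatrix s.succAbove id) e1
    exact this
  have e2' : Cᵀ * L.submatrix s.succAbove s.succAbove = L.submatrix id s.succAbove := by
    have := congrArg (fun M => M.submatrix id s.succAbove) e2
    exact this
  have key : L.submatrix s.succAbove s.succAbove * X * L.submatrix s.succAbove s.succAbove
      = L.submatrix s.succAbove s.succAbove := by
    calc _ = (L.submatrix s.succAbove s.succAbove * C) * N
          * (Cᵀ * L.submatrix s.succAbove s.succAbove) := by
          rw [e3]; simp only [Matrix.mul_assoc]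
      _ = (L * N * L).submatrix s.succAbove s.succAbove := by
          rw [e1', e2']; rfl
      _ = _ := by rw [hLNL]
  refine ⟨key, fun hu => ?_⟩
  have h1 := hu.mul_right_cancel (key.trans (one_mul _).symm)
  exact (Matrix.inv_eq_right_inv h1).symm
end

section
/- Let Q be an m×m real matrix with nonnegative entries such that every row sum of Q is at most 1, and suppose there are an integer τ ≥ 1 and a real δ with 0 < δ ≤ 1 such that every row sum of Q^τ is at most 1 − δ. Then for every k ≥ 0 the maximum row sum of Qᵏ is at most (1 − δ)^{⌊k/τ⌋}, the series ∑_{k=0}^∞ Qᵏ converges, I − Q is invertible with (I − Q)⁻¹ = ∑_{k=0}^∞ Qᵏ, and every row sum of (I − Q)⁻¹ is at most ∑_{k=0}^∞ (1 − δ)^{⌊k/τ⌋} = τ/δ. (Applied with Q = P_{−s}, δ = d_max^{−τ} and τ the diameter, this gives max_{i≠s} H(i,s) = ‖(I − P_{−s})⁻¹·𝟙‖_∞ ≤ τ·d_max^{τ} for the hitting times to s.) -/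
open Matrix BigOperators

/-- (Hitting-time bound, cf. Eq. (5) of the paper.) Let `Q` be a
nonnegative substochastic matrix (row sums `≤ 1`) such that every row sum of `Q^τ` is
at most `1 − δ` for some `τ ≥ 1` and `0 < δ ≤ 1`. Then every row sum of `Qᵏ` is at
most `(1 − δ)^⌊k/τ⌋`, the series `∑ Qᵏ` converges, `I − Q` is invertible with
`(I − Q)⁻¹ = ∑ Qᵏ`, and every row sum of `(I − Q)⁻¹` is at most
`∑ₖ (1 − δ)^⌊k/τ⌋ = τ/δ`. -/
theorem substochastic_neumann_row_sum_bound {m : ℕ} (Q : Matrix (Fin m) (Fin m) ℝ)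
    (hQnn : ∀ i j, 0 ≤ Q i j) (hQrow : ∀ i, ∑ j, Q i j ≤ 1)
    (τ : ℕ) (hτ : 1 ≤ τ) (δ : ℝ) (hδ0 : 0 < δ) (hδ1 : δ ≤ 1)
    (hQτ : ∀ i, ∑ j, (Q ^ τ) i j ≤ 1 - δ) :
    (∀ (k : ℕ) (i : Fin m), ∑ j, (Q ^ k) i j ≤ (1 - δ) ^ (k / τ)) ∧
    Summable (fun k : ℕ => Q ^ k) ∧
    IsUnit (1 - Q) ∧
    (1 - Q)⁻¹ = ∑' k : ℕ, Q ^ k ∧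
    (∑' k : ℕ, (1 - δ) ^ (k / τ)) = τ / δ ∧
    (∀ i : Fin m, ∑ j, (1 - Q)⁻¹ i j ≤ τ / δ) := by
  have hr0 : (0:ℝ) ≤ 1 - δ := by linarith
  have hr1 : 1 - δ < 1 := by linarith
  have hnn : ∀ (k : ℕ) (i j : Fin m), 0 ≤ (Q ^ k) i j := by
    intro k
    induction k with
    | zero =>
      intro i j
      rw [pow_zero, Matrix.one_apply]
      split_ifs <;> norm_num
    | succ k ih =>
      intro i j
      rw [pow_succ, Matrix.mul_apply]
      exact Finset.sum_nonneg fun l _ => mul_nonneg (ih i l) (hQnn l j)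
  have hmul : ∀ (A B : Matrix (Fin m) (Fin m) ℝ) (a b : ℝ), (∀ i j, 0 ≤ A i j) → 0 ≤ b →
      (∀ i, ∑ j, A i j ≤ a) → (∀ i, ∑ j, B i j ≤ b) → ∀ i, ∑ j, (A * B) i j ≤ a * b := by
    intro A B a b hA hb ha hB i
    calc ∑ j, (A * B) i j = ∑ l, A i l * ∑ j, B l j := by
          simp only [Matrix.mul_apply, Finset.mul_sum]
          exact Finset.sum_comm
      _ ≤ ∑ l, A i l * b := Finset.sum_le_sum fun l _ =>
          mul_le_mul_of_nonneg_left (hB l) (hA i l)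
      _ = (∑ l, A i l) * b := by rw [Finset.sum_mul]
      _ ≤ a * b := mul_le_mul_of_nonneg_right (ha i) hb
  have hone : ∀ (k : ℕ) (i : Fin m), ∑ j, (Q ^ k) i j ≤ 1 := by
    intro k
    induction k with
    | zero => intro i; simp [Matrix.one_apply]
    | succ k ih =>
      intro i
      have := hmul (Q ^ k) Q 1 1 (hnn k) zero_le_one ih hQrow i
      rw [pow_succ]
      simpa using this
  have hτq : ∀ (q : ℕ) (i : Fin m), ∑ j, (Q ^ (τ * q)) i j ≤ (1 - δ) ^ q := by
    intro q
    induction q with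
    | zero => intro i; simp [Matrix.one_apply]
    | succ q ih =>
      intro i
      have := hmul (Q ^ (τ * q)) (Q ^ τ) _ _ (hnn _) hr0 ih hQτ i
      rw [Nat.mul_succ, pow_add, pow_succ (1 - δ)]
      exact this
  have h1 : ∀ (k : ℕ) (i : Fin m), ∑ j, (Q ^ k) i j ≤ (1 - δ) ^ (k / τ) := by
    intro k i
    have := hmul (Q ^ (τ * (k / τ))) (Q ^ (k % τ)) _ _ (hnn _) zero_le_one
      (hτq (k / τ)) (hone _) i
    rwa [← pow_add, Nat.div_add_mod, mul_one] at this
  have hS : HasSum (fun k : ℕ => (1 - δ) ^ (k / τ)) (τ / δ) := by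
    haveI : NeZero τ := ⟨by omega⟩
    have hg := hasSum_geometric_of_lt_one hr0 hr1
    have hc : HasSum (fun _ : Fin τ => (1:ℝ)) (∑ _ : Fin τ, (1:ℝ)) := hasSum_fintype _
    have hp := hg.mul hc (hg.summable.mul_of_nonneg hc.summable
      (fun q => pow_nonneg hr0 q) (fun _ => zero_le_one))
    have he := (Nat.divModEquiv τ).hasSum_iff.mpr hp
    have hv : (1 - (1 - δ))⁻¹ * ∑ _ : Fin τ, (1:ℝ) = τ / δ := by
      simp [div_eq_mul_inv, mul_comm]
    rw [hv] at he
    refine he.congr_fun ?_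
    intro k
    simp
  have hle : ∀ (k : ℕ) (i j : Fin m), (Q ^ k) i j ≤ (1 - δ) ^ (k / τ) := fun k i j =>
    (Finset.single_le_sum (fun l _ => hnn k i l) (Finset.mem_univ j)).trans (h1 k i)
  have hsE : ∀ i j, Summable (fun k : ℕ => (Q ^ k) i j) := fun i j =>
    Summable.of_nonneg_of_le (fun k => hnn k i j) (fun k => hle k i j) hS.summable
  have hsum : Summable (fun k : ℕ => Q ^ k) :=
    Pi.summable.mpr fun i => Pi.summable.mpr fun j => hsE i j
  have hinv : (1 - Q) * (∑' k : ℕ, Q ^ k) = 1 := hsum.one_sub_mul_tsum_pow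
  have hI : (1 - Q)⁻¹ = ∑' k : ℕ, Q ^ k := Matrix.inv_eq_right_inv hinv
  refine ⟨h1, hsum, IsUnit.of_mul_eq_one _ hinv, hI, hS.tsum_eq, ?_⟩
  intro i
  rw [hI]
  have hE : ∀ j, HasSum (fun k : ℕ => (Q ^ k) i j) ((∑' k : ℕ, Q ^ k) i j) := fun j =>
    Pi.hasSum.mp (Pi.hasSum.mp hsum.hasSum i) j
  have hR := hasSum_sum (s := Finset.univ) fun j _ => hE j
  exact hasSum_le (fun k => h1 k i) hR hS
end
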